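/- Let α be a countable ordinal with α ≥ 1, let V ⊆ ω^ω be a Π⁰_α set, let W ⊆ ω^ω be Π⁰_α-hard, and let (W_i)_{i∈ℕ} be a partition of W into Borel sets. Then there exist a continuous function φ : ω^ω → ω^ω and i ∈ ℕ such that φ(V) ⊆ W_i and φ(ω^ω \ V) ⊆ ω^ω \ W. -/

import Mathlib

/-- Baire space `ω^ω`. -/
abbrev NNSpace : Type := ℕ → ℕ

/-- The boldface pointclasses on Baire space: `SigmaPi true α s` means `s` is `Σ⁰_α`,
and `SigmaPi false α s` means `s` is `Π⁰_α` (a complement of a `Σ⁰_α` set).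
`Σ⁰_1` is the class of open sets, and for `α > 1`, `Σ⁰_α` consists of countable unions
`⋃ n, C n` where each `C n` is `Π⁰_{β n}` for some `1 ≤ β n < α`. -/
inductive SigmaPi : Bool → Ordinal.{0} → Set NNSpace → Prop
  | open_ (s : Set NNSpace) (hs : IsOpen s) : SigmaPi true 1 s
  | compl (α : Ordinal) (s : Set NNSpace) (h : SigmaPi true α s) : SigmaPi false α sᶜ
  | iUnion (α : Ordinal) (hα : 1 < α) (C : ℕ → Set NNSpace) (β : ℕ → Ordinal)
      (hβ : ∀ n, 1 ≤ β n ∧ β n < α) (h : ∀ n, SigmaPi false (β n) (C n)) :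
      SigmaPi true α (⋃ n, C n)

/-- `W` is `Π⁰_α`-hard: every `Π⁰_α` set is a continuous preimage of `W`. -/
def Pi0Hard (α : Ordinal.{0}) (W : Set NNSpace) : Prop :=
  ∀ V : Set NNSpace, SigmaPi false α V →
    ∃ φ : NNSpace → NNSpace, Continuous φ ∧ V = φ ⁻¹' W

section

open Set

namespace SigmaPi

theorem one_le {b : Bool} {α : Ordinal.{0}} {s : Set NNSpace} (h : SigmaPi b α s) : 1 ≤ α := by
  induction h with
  | open_ => exact le_rfl
  | compl _ _ _ ih => exact ih
  | iUnion _ h => exact h.le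

theorem pi_iff {α : Ordinal.{0}} {s : Set NNSpace} :
    SigmaPi false α s ↔ SigmaPi true α sᶜ := by
  constructor
  · intro h
    cases h with
    | compl _ t h => simpa using h
  · intro h
    simpa using SigmaPi.compl α _ h

theorem isOpen {s : Set NNSpace} (h : SigmaPi true 1 s) : IsOpen s := by
  generalize hα : (1 : Ordinal.{0}) = α at h
  cases h with
  | open_ _ hs => exact hs
  | iUnion _ h => exact absurd hα h.ne

theorem exists_iUnion {α : Ordinal.{0}} {s : Set NNSpace} (h : SigmaPi true α s) (hα : 1 < α) :
    ∃ (C : ℕ → Set NNSpace) (β : ℕ → Ordinal.{0}), (∀ n, 1 ≤ β n ∧ β n < α) ∧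
      (∀ n, SigmaPi false (β n) (C n)) ∧ s = ⋃ n, C n := by
  cases h with
  | open_ _ hs => exact absurd hα (lt_irrefl _)
  | iUnion _ _ C β hβ h => exact ⟨C, β, hβ, h, rfl⟩

theorem sigma_of_pi {α β : Ordinal.{0}} {s : Set NNSpace} (h : SigmaPi false β s) (hβ : β < α) :
    SigmaPi true α s := by
  have := SigmaPi.iUnion α (h.one_le.trans_lt hβ) (fun _ => s) (fun _ => β)
    (fun _ => ⟨h.one_le, hβ⟩) (fun _ => h)
  rwa [iUnion_const] at this

theorem of_isOpen {α : Ordinal.{0}} (hα : 1 ≤ α) {s : Set NNSpace} (hs : IsOpen s) :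
    SigmaPi true α s := by
  rcases hα.eq_or_lt with rfl | hα
  · exact .open_ s hs
  · let := TopologicalSpace.pseudoMetrizableSpacePseudoMetric NNSpace
    obtain ⟨F, hF, -, rfl, -⟩ := hs.exists_iUnion_isClosed
    exact .iUnion α hα F (fun _ => 1) (fun _ => ⟨le_rfl, hα⟩)
      fun n => pi_iff.2 (.open_ _ (hF n).isOpen_compl)

theorem mono {α β : Ordinal.{0}} {s : Set NNSpace} (h : SigmaPi true β s) (hβ : β ≤ α) :
    SigmaPi true α s := by
  rcases h.one_le.eq_or_lt with rfl | h1
  · exact of_isOpen hβ h.isOpen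
  · obtain ⟨C, γ, hγ, hC, rfl⟩ := h.exists_iUnion h1
    exact .iUnion α (h1.trans_le hβ) C γ (fun n => ⟨(hγ n).1, (hγ n).2.trans_le hβ⟩) hC

theorem sigma_iUnion {α : Ordinal.{0}} {S : ℕ → Set NNSpace}
    (h : ∀ n, SigmaPi true α (S n)) : SigmaPi true α (⋃ n, S n) := by
  rcases (h 0).one_le.eq_or_lt with rfl | hα
  · exact .open_ _ (isOpen_iUnion fun n => (h n).isOpen)
  · choose C β hβ hC hS using fun n => (h n).exists_iUnion hα
    have := SigmaPi.iUnion α hα (fun k => C k.unpair.1 k.unpair.2)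
      (fun k => β k.unpair.1 k.unpair.2) (fun k => hβ _ _) (fun k => hC _ _)
    convert this using 1
    simp_rw [hS]
    exact (iUnion_unpair fun i j => C i j).symm

theorem sigma_sUnion {α : Ordinal.{0}} (hα : 1 ≤ α) {𝒮 : Set (Set NNSpace)} (hc : 𝒮.Countable)
    (h : ∀ S ∈ 𝒮, SigmaPi true α S) : SigmaPi true α (⋃₀ 𝒮) := by
  rcases 𝒮.eq_empty_or_nonempty with rfl | hne
  · simpa using of_isOpen hα isOpen_empty
  · obtain ⟨f, rfl⟩ := hc.exists_eq_range hne
    rw [sUnion_range]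
    exact sigma_iUnion fun n => h _ ⟨n, rfl⟩

theorem sigma_union {α : Ordinal.{0}} {s t : Set NNSpace} (hs : SigmaPi true α s)
    (ht : SigmaPi true α t) : SigmaPi true α (s ∪ t) := by
  rw [← sUnion_pair]
  exact sigma_sUnion hs.one_le (by simp) (by rintro S (rfl | rfl) <;> assumption)

theorem sigma_inter {α : Ordinal.{0}} {s t : Set NNSpace} (hs : SigmaPi true α s)
    (ht : SigmaPi true α t) : SigmaPi true α (s ∩ t) := by
  rcases hs.one_le.eq_or_lt with rfl | hα
  · exact .open_ _ (hs.isOpen.inter ht.isOpen)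
  · obtain ⟨C, β, hβ, hC, rfl⟩ := hs.exists_iUnion hα
    obtain ⟨D, γ, hγ, hD, rfl⟩ := ht.exists_iUnion hα
    rw [iUnion_inter_iUnion]
    refine sigma_iUnion fun i => sigma_iUnion fun j => ?_
    refine sigma_of_pi (β := max (β i) (γ j)) (pi_iff.2 ?_) (max_lt (hβ i).2 (hγ j).2)
    rw [compl_inter]
    exact sigma_union ((pi_iff.1 (hC i)).mono (le_max_left _ _))
      ((pi_iff.1 (hD j)).mono (le_max_right _ _))

theorem preimage {b : Bool} {α : Ordinal.{0}} {s : Set NNSpace} (h : SigmaPi b α s)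
    {f : NNSpace → NNSpace} (hf : Continuous f) : SigmaPi b α (f ⁻¹' s) := by
  induction h with
  | open_ s hs => exact .open_ _ (hs.preimage hf)
  | compl α s _ ih => exact .compl α _ ih
  | iUnion α hα C β hβ _ ih =>
    rw [preimage_iUnion]
    exact .iUnion α hα _ β hβ ih

/-- A universal `Σ⁰_α` set, presented as a family of sections. -/
theorem exists_universal (α : Ordinal.{0}) (h1 : 1 ≤ α) (hc : α.card ≤ Cardinal.aleph0) :
    ∃ U : NNSpace → Set NNSpace, (∀ S, SigmaPi true α S → ∃ c, S = U c) ∧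
      ∀ f g : NNSpace → NNSpace, Continuous f → Continuous g →
        SigmaPi true α {x | f x ∈ U (g x)} := by
  induction α using WellFoundedLT.induction with
  | ind α ih =>
  rcases h1.eq_or_lt with rfl | hα
  · obtain ⟨b, hb, -, hbasis⟩ := TopologicalSpace.exists_countable_basis NNSpace
    obtain ⟨u, hu⟩ := (hb.insert ∅).exists_eq_range (insert_nonempty _ _)
    have hopen : ∀ n, IsOpen (u n) := by
      intro n
      have : u n ∈ insert ∅ b := hu ▸ mem_range_self n
      rcases this with h | h
      · exact h ▸ isOpen_empty
      · exact hbasis.isOpen h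
    refine ⟨fun c => ⋃ n, u (c n), ?_, ?_⟩
    · intro S hS
      obtain ⟨T, hT, rfl⟩ := hbasis.open_eq_sUnion hS.isOpen
      have hT' : (insert ∅ T).Countable := (hb.mono hT).insert ∅
      obtain ⟨v, hv⟩ := hT'.exists_eq_range (insert_nonempty _ _)
      have : ∀ n, ∃ m, u m = v n := by
        intro n
        have : v n ∈ insert ∅ T := hv ▸ mem_range_self n
        have : v n ∈ range u := hu ▸ insert_subset_insert hT this
        exact this
      choose c hcv using this
      refine ⟨c, ?_⟩
      simp only [hcv]
      rw [← sUnion_range, ← hv, sUnion_insert, empty_union]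
    · intro f g hf hg
      refine .open_ _ ?_
      have : {x | f x ∈ ⋃ n, u (g x n)} = ⋃ n, ⋃ m, ({x | g x n = m} ∩ f ⁻¹' u m) := by
        ext x; simp
      rw [this]
      refine isOpen_iUnion fun n => isOpen_iUnion fun m => IsOpen.inter ?_ ((hopen m).preimage hf)
      exact (isOpen_discrete {m}).preimage ((continuous_apply n).comp hg)
  · have hcount : (Ico 1 α).Countable := by
      have : (Iio α).Countable := by
        rw [← Cardinal.le_aleph0_iff_set_countable, Cardinal.mk_Iio_ordinal,
          ← Cardinal.lift_aleph0.{1, 0}, Cardinal.lift_le]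
        exact hc
      exact this.mono Ico_subset_Iio_self
    obtain ⟨b, hb⟩ := hcount.exists_eq_range ⟨1, le_rfl, hα⟩
    have hbm : ∀ n, b n ∈ Ico 1 α := fun n => hb ▸ mem_range_self n
    choose U hU hUc using fun n => ih (b n) (hbm n).2 (hbm n).1
      ((Ordinal.card_le_card (hbm n).2.le).trans hc)
    refine ⟨fun c => ⋃ n, (U (c (Nat.pair n 0)) (fun k => c (Nat.pair n (k + 1))))ᶜ, ?_, ?_⟩
    · intro S hS
      obtain ⟨C, β, hβ, hC, rfl⟩ := hS.exists_iUnion hα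
      have h1 : ∀ n, ∃ m, b m = β n := fun n => by
        have : β n ∈ range b := hb ▸ hβ n
        exact this
      choose m hm using h1
      have h2 : ∀ n, ∃ d, (C n)ᶜ = U (m n) d := fun n =>
        hU (m n) _ (by rw [hm]; exact pi_iff.1 (hC n))
      choose d hd using h2
      refine ⟨fun p => Nat.casesOn p.unpair.2 (m p.unpair.1) (d p.unpair.1), ?_⟩
      refine iUnion_congr fun n => ?_
      simp [← hd]
    · intro f g hf hg
      have : {x | f x ∈ ⋃ n, (U (g x (Nat.pair n 0)) (fun k => g x (Nat.pair n (k + 1))))ᶜ} =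
          ⋃ n, ⋃ m, ({x | g x (Nat.pair n 0) = m} ∩
            {x | f x ∈ U m (fun k => g x (Nat.pair n (k + 1)))}ᶜ) := by
        ext x; simp
      rw [this]
      refine sigma_iUnion fun n => sigma_iUnion fun m => sigma_inter ?_ ?_
      · exact of_isOpen h1 ((isOpen_discrete {m}).preimage ((continuous_apply _).comp hg))
      · refine sigma_of_pi (.compl _ _ (hUc m f _ hf ?_)) (hbm m).2
        exact continuous_pi fun k => (continuous_apply _).comp hg

theorem exists_pi_not_sigma (α : Ordinal.{0}) (h1 : 1 ≤ α) (hc : α.card ≤ Cardinal.aleph0) :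
    ∃ S, SigmaPi false α S ∧ ¬ SigmaPi true α S := by
  obtain ⟨U, hU, hUc⟩ := exists_universal α h1 hc
  refine ⟨{x | x ∈ U x}ᶜ, .compl _ _ (hUc id id continuous_id continuous_id), fun h => ?_⟩
  obtain ⟨c, hc⟩ := hU _ h
  have : c ∈ {x | x ∈ U x}ᶜ ↔ c ∈ U c := by rw [← hc]
  simp at this

end SigmaPi

/-- A countable family of sets, each of rank above `1` being the complement of the union of
members of smaller rank, and those of rank `1` being closed. -/
structure Code where
  set : ℕ → Set NNSpace
  rank : ℕ → Ordinal.{0}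
  child : ℕ → ℕ → ℕ
  one_le_rank : ∀ k, 1 ≤ rank k
  isClosed : ∀ k, rank k = 1 → IsClosed (set k)
  child_lt : ∀ k, rank k ≠ 1 → ∀ n, rank (child k n) < rank k
  compl_eq : ∀ k, rank k ≠ 1 → (set k)ᶜ = ⋃ n, set (child k n)

/-- Every `Π⁰_α` set is coded by a countable family of the `Π⁰` sets from which it is built. -/
theorem SigmaPi.exists_code {α : Ordinal.{0}} {V : Set NNSpace} (hV : SigmaPi false α V) :
    ∃ (K : Code) (r : ℕ), K.set r = V ∧ K.rank r = α := by
  let P := {p : Ordinal.{0} × Set NNSpace // SigmaPi false p.1 p.2}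
  have hchild : ∀ p : P, ∃ q : ℕ → P, p.1.1 ≠ 1 →
      (∀ n, (q n).1.1 < p.1.1) ∧ (p.1.2)ᶜ = ⋃ n, (q n).1.2 := by
    intro p
    by_cases h : p.1.1 = 1
    · exact ⟨fun _ => p, fun h' => absurd h h'⟩
    · obtain ⟨C, β, hβ, hC, hs⟩ :=
        (pi_iff.1 p.2).exists_iUnion (lt_of_le_of_ne p.2.one_le (Ne.symm h))
      exact ⟨fun n => ⟨(β n, C n), hC n⟩, fun _ => ⟨fun n => (hβ n).2, hs⟩⟩
  choose q hq using hchild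
  let node : List ℕ → P := fun l => l.foldl q ⟨(α, V), hV⟩
  let eqv := Denumerable.eqv (List ℕ)
  refine ⟨⟨fun k => (node (eqv.symm k)).1.2, fun k => (node (eqv.symm k)).1.1,
    fun k n => eqv (eqv.symm k ++ [n]), fun k => (node _).2.one_le, fun k hk => ?_,
    fun k hk => ?_, fun k hk => ?_⟩, eqv [], ?_, ?_⟩
  · have := pi_iff.1 (node (eqv.symm k)).2
    rw [show (node (eqv.symm k)).1.1 = 1 from hk] at this
    exact isOpen_compl_iff.1 this.isOpen
  · simpa [node] using (hq (node (eqv.symm k)) hk).1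
  · simpa [node] using (hq (node (eqv.symm k)) hk).2
  · simp [node]
  · simp [node]

/-- The relations of one level of the true stage construction. -/
structure Stage where
  le : ℕ → ℕ → Prop
  ref : ℕ → ℕ → Prop
  dec : ℕ → ℕ → Prop

namespace Code

variable (K : Code) (x : NNSpace)

/-- The first `n` values of `x` show that `x` is not in the `k`-th set. -/
def base (k n : ℕ) : Prop := Disjoint (PiNat.cylinder x n) (K.set k)

/-- The level `η` of the true stage construction along `x`. -/
noncomputable def stage (η : Ordinal.{0}) : Stage :=
  let pre : ℕ → ℕ → Prop := fun i j => i ≤ j ∧ ∀ ζ, ∀ _ : ζ < η, (stage ζ).le i j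
  let ref : ℕ → ℕ → Prop := fun k u => K.base x k u ∨ ∃ v n, pre v u ∧
    ∃ _ : K.rank (K.child k n) < η, (stage (K.rank (K.child k n))).dec (K.child k n) v ∧
      ¬ (stage (K.rank (K.child k n))).ref (K.child k n) v
  let dec : ℕ → ℕ → Prop := fun k v => k < {i | i < v ∧ pre i v}.ncard ∧
    ∀ k', K.rank k' = η → (ref k' v ∧ ∀ i < v, pre i v → ¬ ref k' i) → k < k'
  ⟨fun i j => pre i j ∧ ∀ k, K.rank k = η → dec k i → ref k j → ref k i, ref, dec⟩
termination_by η

/-- `i` looks true at level `η` from `j`. -/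
def le (η : Ordinal.{0}) (i j : ℕ) : Prop := (K.stage x η).le i j

/-- `i` looks true from `j` at all levels below `η`. -/
def pre (η : Ordinal.{0}) (i j : ℕ) : Prop := i ≤ j ∧ ∀ ζ < η, K.le x ζ i j

/-- At stage `u`, membership in the `k`-th set looks refuted. -/
def ref (k u : ℕ) : Prop := (K.stage x (K.rank k)).ref k u

/-- At stage `v`, a decision about membership in the `k`-th set is made. -/
def dec (k v : ℕ) : Prop := (K.stage x (K.rank k)).dec k v

/-- At stage `u`, membership in the `k`-th set is refuted for the first time. -/
def new (k u : ℕ) : Prop := K.ref x k u ∧ ∀ i < u, K.pre x (K.rank k) i u → ¬ K.ref x k i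

/-- The number of stages strictly before `v` that look true below level `η`. -/
noncomputable def height (η : Ordinal.{0}) (v : ℕ) : ℕ := {i | i < v ∧ K.pre x η i v}.ncard

variable {K x}

theorem ref_iff {k u : ℕ} : K.ref x k u ↔ K.base x k u ∨ ∃ v n, K.pre x (K.rank k) v u ∧
    K.rank (K.child k n) < K.rank k ∧ K.dec x (K.child k n) v ∧ ¬ K.ref x (K.child k n) v := by
  rw [ref, stage]
  simp only [exists_prop]
  rfl

theorem dec_iff {k v : ℕ} : K.dec x k v ↔ k < K.height x (K.rank k) v ∧
    ∀ k', K.rank k' = K.rank k → K.new x k' v → k < k' := by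
  have : K.dec x k v ↔ k < K.height x (K.rank k) v ∧ ∀ k', K.rank k' = K.rank k →
      ((K.stage x (K.rank k)).ref k' v ∧
        ∀ i < v, K.pre x (K.rank k) i v → ¬ (K.stage x (K.rank k)).ref k' i) → k < k' := by
    rw [dec, stage]
    rfl
  rw [this]
  refine and_congr_right fun _ => forall_congr' fun k' => forall_congr' fun h => ?_
  rw [← h]
  rfl

theorem le_iff {η : Ordinal.{0}} {i j : ℕ} : K.le x η i j ↔ K.pre x η i j ∧
    ∀ k, K.rank k = η → K.dec x k i → K.ref x k j → K.ref x k i := by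
  have : K.le x η i j ↔ K.pre x η i j ∧ ∀ k, K.rank k = η → (K.stage x η).dec k i →
      (K.stage x η).ref k j → (K.stage x η).ref k i := by
    rw [le, stage]
    rfl
  rw [this]
  refine and_congr_right fun _ => forall_congr' fun k => forall_congr' fun h => ?_
  subst h
  rfl

theorem le.pre {η : Ordinal.{0}} {i j : ℕ} (h : K.le x η i j) : K.pre x η i j := (le_iff.1 h).1

theorem pre.mono {η ζ : Ordinal.{0}} {i j : ℕ} (h : K.pre x η i j) (hζ : ζ ≤ η) :
    K.pre x ζ i j := ⟨h.1, fun θ hθ => h.2 θ (hθ.trans_le hζ)⟩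

theorem le.mono {η ζ : Ordinal.{0}} {i j : ℕ} (h : K.le x η i j) (hζ : ζ ≤ η) :
    K.le x ζ i j := by
  rcases hζ.eq_or_lt with rfl | hζ
  · exact h
  · exact h.pre.2 ζ hζ

theorem le_refl (η : Ordinal.{0}) (i : ℕ) : K.le x η i i := by
  induction η using WellFoundedLT.induction with
  | ind η ih => exact le_iff.2 ⟨⟨le_rfl, ih⟩, fun _ _ _ h => h⟩

theorem pre_refl (η : Ordinal.{0}) (i : ℕ) : K.pre x η i i := (le_refl η i).pre

theorem base_mono {k u v : ℕ} (h : u ≤ v) (hu : K.base x k u) : K.base x k v :=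
  hu.mono_left (PiNat.cylinder_anti x h)

theorem height_mono {η : Ordinal.{0}} {i j : ℕ} (hij : i ≤ j)
    (h : ∀ v, K.pre x η v i → K.pre x η v j) : K.height x η i ≤ K.height x η j :=
  ncard_le_ncard (fun v hv => ⟨hv.1.trans_le hij, h v hv.2⟩)
    ((finite_Iio j).subset fun _ h => h.1)

theorem height_le (η : Ordinal.{0}) (v : ℕ) : K.height x η v ≤ v := by
  have := ncard_le_ncard (s := {i | i < v ∧ K.pre x η i v}) (t := Iio v)
    (fun _ h => h.1) (finite_Iio v)
  simpa [height] using this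

theorem le_trans {η : Ordinal.{0}} : ∀ {i j l : ℕ}, K.le x η i j → K.le x η j l →
    K.le x η i l := by
  induction η using WellFoundedLT.induction with
  | ind η ih =>
  intro i j l hij hjl
  have htr : ∀ {i j l : ℕ}, K.pre x η i j → K.pre x η j l → K.pre x η i l := fun h1 h2 =>
    ⟨h1.1.trans h2.1, fun ζ hζ => ih ζ hζ (h1.2 ζ hζ) (h2.2 ζ hζ)⟩
  refine le_iff.2 ⟨htr hij.pre hjl.pre, fun k hk hd hl => ?_⟩
  refine (le_iff.1 hij).2 k hk hd ((le_iff.1 hjl).2 k hk ?_ hl)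
  subst hk
  rw [dec_iff] at hd ⊢
  refine ⟨hd.1.trans_le (height_mono hij.pre.1 fun v hv => htr hv hij.pre), fun k' hk' hn => ?_⟩
  rcases hij.pre.1.eq_or_lt with rfl | hlt
  · exact hd.2 k' hk' hn
  · have hnr : ¬ K.ref x k' i := hn.2 i hlt (hk' ▸ hij.pre)
    have hnd : ¬ K.dec x k' i := fun h => hnr ((le_iff.1 hij).2 k' hk' h hn.1)
    rw [dec_iff] at hnd
    push Not at hnd
    by_cases hh : k' < K.height x (K.rank k') i
    · obtain ⟨k₂, hk₂, hn₂, hle⟩ := hnd hh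
      exact (hd.2 k₂ (hk₂.trans hk') hn₂).trans_le hle
    · rw [hk'] at hh
      exact hd.1.trans_le (not_lt.1 hh)

theorem pre_trans {η : Ordinal.{0}} {i j l : ℕ} (h1 : K.pre x η i j) (h2 : K.pre x η j l) :
    K.pre x η i l :=
  ⟨h1.1.trans h2.1, fun ζ hζ => le_trans (h1.2 ζ hζ) (h2.2 ζ hζ)⟩

theorem ref_mono {k u v : ℕ} (h : K.pre x (K.rank k) u v) (hu : K.ref x k u) :
    K.ref x k v := by
  rw [ref_iff] at hu ⊢
  refine hu.imp (base_mono h.1) ?_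
  rintro ⟨w, n, hw, hr⟩
  exact ⟨w, n, pre_trans hw h, hr⟩

theorem le_of_pre {η : Ordinal.{0}} {i j l : ℕ} (hij : i ≤ j) (hil : K.le x η i l)
    (hjl : K.pre x η j l) : K.le x η i j := by
  induction η using WellFoundedLT.induction with
  | ind η ih =>
  refine le_iff.2 ⟨⟨hij, fun ζ hζ => ih ζ hζ (hil.mono hζ.le) (hjl.mono hζ.le)⟩, ?_⟩
  intro k hk hd hr
  exact (le_iff.1 hil).2 k hk hd (ref_mono (hk ▸ hjl) hr)

theorem exists_lt_of_not_le {η : Ordinal.{0}} {j l : ℕ} (h : K.pre x η j l)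
    (hn : ¬ K.le x η j l) : ∃ k < j, K.rank k = η := by
  by_contra! hk
  refine hn (le_iff.2 ⟨h, fun k hkη hd => absurd hkη (hk k ?_)⟩)
  exact (dec_iff.1 hd).1.trans_le (height_le _ _)

theorem le_zero (η : Ordinal.{0}) (j : ℕ) : K.le x η 0 j := by
  induction η using WellFoundedLT.induction with
  | ind η ih =>
  by_contra h
  obtain ⟨k, hk, -⟩ := exists_lt_of_not_le ⟨Nat.zero_le j, ih⟩ h
  exact absurd hk (Nat.not_lt_zero k)

theorem pre_zero (η : Ordinal.{0}) (j : ℕ) : K.pre x η 0 j := (le_zero η j).pre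

theorem pre_one {i j : ℕ} (h : i ≤ j) : K.pre x 1 i j := by
  refine ⟨h, fun ζ hζ => ?_⟩
  obtain rfl := Order.lt_one_iff.1 hζ
  by_contra hn
  obtain ⟨k, -, hk⟩ := exists_lt_of_not_le ⟨h, fun ζ hζ => absurd hζ not_lt_bot⟩ hn
  exact absurd (K.one_le_rank k) (by simp [hk])

theorem local_aux {y : NNSpace} {n : ℕ} (hxy : ∀ i < n, x i = y i) (η : Ordinal.{0}) :
    (∀ i j, j ≤ n → (K.le x η i j ↔ K.le y η i j)) ∧
    ∀ k, K.rank k = η → ∀ u ≤ n, (K.ref x k u ↔ K.ref y k u) ∧ (K.dec x k u ↔ K.dec y k u) := by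
  induction η using WellFoundedLT.induction with
  | ind η ih =>
  have hpre : ∀ i j, j ≤ n → (K.pre x η i j ↔ K.pre y η i j) := fun i j hj =>
    and_congr_right fun _ => forall₂_congr fun ζ hζ => (ih ζ hζ).1 i j hj
  have href : ∀ k, K.rank k = η → ∀ u ≤ n, (K.ref x k u ↔ K.ref y k u) := by
    intro k hk u hu
    rw [ref_iff, ref_iff]
    refine or_congr ?_ (exists₂_congr fun v m => ?_)
    · have : PiNat.cylinder x u = PiNat.cylinder y u :=
        PiNat.mem_cylinder_iff_eq.1
          (PiNat.mem_cylinder_iff.2 fun i hi => hxy i (hi.trans_le hu))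
      rw [base, base, this]
    · rw [hk, hpre v u hu]
      refine and_congr_right fun hv => and_congr_right fun hlt => ?_
      have := (ih _ hlt).2 _ rfl v (hv.1.trans hu)
      rw [this.1, this.2]
  have hnew : ∀ k, K.rank k = η → ∀ u ≤ n, (K.new x k u ↔ K.new y k u) := by
    intro k hk u hu
    rw [new, new, hk, href k hk u hu]
    refine and_congr_right fun _ => forall₂_congr fun i hi => ?_
    rw [hpre i u hu, href k hk i (hi.le.trans hu)]
  have hdec : ∀ k, K.rank k = η → ∀ u ≤ n, (K.dec x k u ↔ K.dec y k u) := by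
    intro k hk u hu
    rw [dec_iff, dec_iff, hk]
    have : K.height x η u = K.height y η u := by
      simp only [height, hpre _ u hu]
    rw [this]
    refine and_congr_right fun _ => forall₂_congr fun k' hk' => ?_
    rw [hnew k' hk' u hu]
  refine ⟨fun i j hj => ?_, fun k hk u hu => ⟨href k hk u hu, hdec k hk u hu⟩⟩
  rw [le_iff, le_iff, hpre i j hj]
  refine and_congr_right fun hi => forall₂_congr fun k hk => ?_
  rw [hdec k hk i (hi.1.trans hj), href k hk j hj, href k hk i (hi.1.trans hj)]

theorem le_congr {y : NNSpace} {n : ℕ} (hxy : ∀ i < n, x i = y i) {η : Ordinal.{0}} {i j : ℕ}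
    (hj : j ≤ n) : K.le x η i j ↔ K.le y η i j := (local_aux hxy η).1 i j hj

theorem pre_congr {y : NNSpace} {n : ℕ} (hxy : ∀ i < n, x i = y i) {η : Ordinal.{0}} {i j : ℕ}
    (hj : j ≤ n) : K.pre x η i j ↔ K.pre y η i j :=
  and_congr_right fun _ => forall₂_congr fun _ _ => le_congr hxy hj

theorem ref_congr {y : NNSpace} {n : ℕ} (hxy : ∀ i < n, x i = y i) {k u : ℕ}
    (hu : u ≤ n) : K.ref x k u ↔ K.ref y k u := ((local_aux hxy _).2 k rfl u hu).1

variable (K x)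

/-- `n` is a true stage at all levels below `η`. -/
def Tr (η : Ordinal.{0}) (n : ℕ) : Prop :=
  ∀ ζ, ∀ _ : ζ < η, Tr ζ n ∧ ∀ m ≥ n, Tr ζ m → K.le x ζ n m
termination_by η

variable {K x}

theorem tr_iff {η : Ordinal.{0}} {n : ℕ} : K.Tr x η n ↔
    ∀ ζ < η, K.Tr x ζ n ∧ ∀ m ≥ n, K.Tr x ζ m → K.le x ζ n m := by
  rw [Tr]

theorem Tr.mono {η ζ : Ordinal.{0}} {n : ℕ} (h : K.Tr x η n) (hζ : ζ ≤ η) : K.Tr x ζ n :=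
  tr_iff.2 fun θ hθ => tr_iff.1 h θ (hθ.trans_le hζ)

theorem Tr.le {η ζ : Ordinal.{0}} {n m : ℕ} (h : K.Tr x η n) (hζ : ζ < η) (hnm : n ≤ m)
    (hm : K.Tr x ζ m) : K.le x ζ n m := (tr_iff.1 h ζ hζ).2 m hnm hm

theorem Tr.pre {η : Ordinal.{0}} {n m : ℕ} (h : K.Tr x η n) (hm : K.Tr x η m) (hnm : n ≤ m) :
    K.pre x η n m :=
  ⟨hnm, fun _ hζ => h.le hζ hnm (hm.mono hζ.le)⟩

theorem Tr.of_pre {η : Ordinal.{0}} {i m : ℕ} (hm : K.Tr x η m) (h : K.pre x η i m) :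
    K.Tr x η i := by
  induction η using WellFoundedLT.induction with
  | ind η ih =>
  refine tr_iff.2 fun ζ hζ => ⟨ih ζ hζ (hm.mono hζ.le) (h.mono hζ.le), fun m' hm' ht => ?_⟩
  rcases le_total m' m with hle | hle
  · exact le_of_pre hm' (h.2 ζ hζ) (ht.pre (hm.mono hζ.le) hle)
  · exact le_trans (h.2 ζ hζ) (hm.le hζ hle ht)

theorem tr_succ {η : Ordinal.{0}} {n : ℕ} (h : K.Tr x η n)
    (hle : ∀ m ≥ n, K.Tr x η m → K.le x η n m) : K.Tr x (Order.succ η) n := by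
  refine tr_iff.2 fun ζ hζ => ?_
  rcases (Order.lt_succ_iff.1 hζ).eq_or_lt with rfl | hζ
  · exact ⟨h, hle⟩
  · exact tr_iff.1 h ζ hζ

theorem exists_new {k i m : ℕ} (hi : K.Tr x (K.rank k) i) (hm : K.Tr x (K.rank k) m)
    (hrm : K.ref x k m) (hri : ¬ K.ref x k i) :
    ∃ u > i, K.Tr x (K.rank k) u ∧ K.new x k u := by
  classical
  have hex : ∃ u, K.Tr x (K.rank k) u ∧ K.ref x k u := ⟨m, hm, hrm⟩
  obtain ⟨hu, hr⟩ := Nat.find_spec hex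
  refine ⟨Nat.find hex, ?_, hu, hr, fun v hv hpre hrv => ?_⟩
  · by_contra! hle
    exact hri (ref_mono (hu.pre hi hle) hr)
  · exact Nat.find_min hex hv ⟨hu.of_pre hpre, hrv⟩

theorem new_unique {k u v : ℕ} (hu : K.Tr x (K.rank k) u) (hv : K.Tr x (K.rank k) v)
    (hnu : K.new x k u) (hnv : K.new x k v) : u = v := by
  rcases lt_trichotomy u v with h | h | h
  · exact absurd hnu.1 (hnv.2 u h (hu.pre hv h.le))
  · exact h
  · exact absurd hnv.1 (hnu.2 v h (hv.pre hu h.le))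

theorem infinite_tr_succ {η : Ordinal.{0}} (h : {n | K.Tr x η n}.Infinite) :
    {n | K.Tr x (Order.succ η) n}.Infinite := by
  classical
  refine Nat.frequently_atTop_iff_infinite.1 (Filter.frequently_atTop.2 fun N => ?_)
  by_cases hex : ∃ k u, K.rank k = η ∧ N ≤ u ∧ K.Tr x η u ∧ K.new x k u
  · obtain ⟨u, hk, hN, hu, hn⟩ := Nat.find_spec hex
    have hmin := fun k' (hk' : k' < Nat.find hex) => Nat.find_min hex hk'
    generalize Nat.find hex = k at *
    subst hk
    refine ⟨u, hN, tr_succ hu fun m hm htm => le_iff.2 ⟨hu.pre htm hm, fun k' hk' hd hr => ?_⟩⟩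
    by_contra hru
    obtain ⟨u', hu', ht', hn'⟩ := exists_new (hk' ▸ hu) (hk' ▸ htm) hr hru
    exact hmin k' ((dec_iff.1 hd).2 k hk'.symm hn) ⟨u', hk', hN.trans hu'.le, hk' ▸ ht', hn'⟩
  · obtain ⟨i, hi, hN⟩ := h.exists_gt N
    refine ⟨i, hN.le, tr_succ hi fun m hm htm => le_iff.2 ⟨hi.pre htm hm, fun k' hk' hd hr => ?_⟩⟩
    by_contra hru
    subst hk'
    obtain ⟨u', hu', ht', hn'⟩ := exists_new hi htm hr hru
    exact hex ⟨k', u', rfl, (hN.trans hu').le, ht', hn'⟩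

theorem infinite_tr (η : Ordinal.{0}) : {n | K.Tr x η n}.Infinite := by
  classical
  induction η using WellFoundedLT.induction with
  | ind η ih =>
  refine Nat.frequently_atTop_iff_infinite.1 (Filter.frequently_atTop.2 fun N => ?_)
  have hθ : ∃ θ ≤ η, {n | K.Tr x θ n}.Infinite ∧ ∀ k ≤ N, K.rank k < η → K.rank k < θ := by
    let F := ((Finset.range (N + 1)).image K.rank).filter (· < η)
    rcases F.eq_empty_or_nonempty with hF | hF
    · refine ⟨0, bot_le, ?_, fun k hk hkη => ?_⟩
      · have : {n | K.Tr x 0 n} = univ :=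
          eq_univ_of_forall fun n => tr_iff.2 fun ζ hζ => absurd hζ not_lt_bot
        rw [this]
        exact infinite_univ
      · have : K.rank k ∈ F := Finset.mem_filter.2
          ⟨Finset.mem_image_of_mem _ (Finset.mem_range.2 (Nat.lt_succ_of_le hk)), hkη⟩
        simp [hF] at this
    · have hM : F.max' hF < η := (Finset.mem_filter.1 (F.max'_mem hF)).2
      refine ⟨Order.succ (F.max' hF), Order.succ_le_of_lt hM, infinite_tr_succ (ih _ hM),
        fun k hk hkη => Order.lt_succ_iff.2 (F.le_max' _ (Finset.mem_filter.2
          ⟨Finset.mem_image_of_mem _ (Finset.mem_range.2 (Nat.lt_succ_of_le hk)), hkη⟩))⟩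
  obtain ⟨θ, hθη, hinf, hN⟩ := hθ
  set n := Nat.nth (K.Tr x θ) N with hn
  have hnt : K.Tr x θ n := Nat.nth_mem_of_infinite hinf N
  have hheight : K.height x θ n ≤ N := by
    have hsub : {i | i < n ∧ K.pre x θ i n} ⊆ ((Finset.range n).filter (K.Tr x θ) : Finset ℕ) := by
      intro i hi
      simpa using ⟨hi.1, hnt.of_pre hi.2⟩
    have := ncard_le_ncard hsub (Finset.finite_toSet _)
    rwa [ncard_coe_finset, ← Nat.count_eq_card_filter_range, hn,
      Nat.count_nth_of_infinite hinf] at this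
  have key : ∀ ζ, θ ≤ ζ → ζ ≤ η → K.Tr x ζ n := by
    intro ζ
    induction ζ using WellFoundedLT.induction with
    | ind ζ ihζ =>
    intro hθζ hζη
    refine tr_iff.2 fun ζ' hζ' => ?_
    by_cases hlt : ζ' < θ
    · exact tr_iff.1 hnt ζ' hlt
    · have hle := not_lt.1 hlt
      have ht := ihζ ζ' hζ' hle (hζ'.le.trans hζη)
      refine ⟨ht, fun m hm htm => le_iff.2 ⟨ht.pre htm hm, fun k hk hd => ?_⟩⟩
      subst hk
      have h1 := (dec_iff.1 hd).1
      have h2 : K.height x (K.rank k) n ≤ K.height x θ n :=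
        ncard_le_ncard (fun v hv => ⟨hv.1, hv.2.mono hle⟩)
          ((finite_Iio n).subset fun _ h => h.1)
      exact absurd (hN k (by omega) (hζ'.trans_le hζη)) hlt
  exact ⟨n, Nat.le_nth fun hfin => absurd hfin hinf, key η hθη le_rfl⟩

theorem exists_tr_dec {ξ : Ordinal.{0}} {k : ℕ} (hk : K.rank k < ξ) :
    ∃ v, K.Tr x ξ v ∧ K.dec x k v := by
  classical
  have hfin : {u | K.Tr x (K.rank k) u ∧ ∃ k' ≤ k, K.rank k' = K.rank k ∧ K.new x k' u}.Finite := by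
    have : {u | K.Tr x (K.rank k) u ∧ ∃ k' ≤ k, K.rank k' = K.rank k ∧ K.new x k' u} ⊆
        ⋃ k' ∈ Iic k, {u | K.Tr x (K.rank k') u ∧ K.new x k' u} := by
      rintro u ⟨hu, k', hk', hr, hn⟩
      simp only [mem_iUnion]
      exact ⟨k', hk', hr ▸ hu, hn⟩
    refine ((finite_Iic k).biUnion fun k' _ => Set.Subsingleton.finite ?_).subset this
    exact fun u hu v hv => new_unique hu.1 hv.1 hu.2 hv.2
  obtain ⟨M, hM⟩ := hfin.bddAbove
  have hinf := infinite_tr (K := K) (x := x) ξ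
  obtain ⟨v, hv, hgt⟩ := hinf.exists_gt (max M (Nat.nth (K.Tr x ξ) k))
  refine ⟨v, hv, dec_iff.2 ⟨?_, fun k' hk' hn => ?_⟩⟩
  · have hsub : (((Finset.range v).filter (K.Tr x ξ) : Finset ℕ) : Set ℕ) ⊆
        {i | i < v ∧ K.pre x (K.rank k) i v} := by
      intro i hi
      simp only [Finset.coe_filter, Finset.mem_range, mem_ofPred_eq] at hi
      exact ⟨hi.1, (hi.2.pre hv hi.1.le).mono hk.le⟩
    have := ncard_le_ncard hsub ((finite_Iio v).subset fun _ h => h.1)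
    rw [ncard_coe_finset, ← Nat.count_eq_card_filter_range] at this
    refine lt_of_lt_of_le ?_ this
    exact (Nat.lt_nth_iff_count_lt hinf).2 ((le_max_right _ _).trans_lt hgt)
  · by_contra! hle
    have := hM (show v ∈ _ from ⟨hv.mono hk.le, k', hle, hk', hn⟩)
    omega

theorem notMem_iff {k : ℕ} : x ∉ K.set k ↔ ∃ u, K.Tr x (K.rank k) u ∧ K.ref x k u := by
  generalize hη : K.rank k = η
  induction η using WellFoundedLT.induction generalizing k with
  | ind η ih =>
  subst hη
  constructor
  · intro hx
    by_cases h1 : K.rank k = 1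
    · have hopen : IsOpen (K.set k)ᶜ := (K.isClosed k h1).isOpen_compl
      obtain ⟨_, ⟨y, n, rfl⟩, hxy, hsub⟩ := (PiNat.isTopologicalBasis_cylinders
        (fun _ : ℕ => ℕ)).exists_subset_of_mem_open (show x ∈ (K.set k)ᶜ from hx) hopen
      obtain ⟨u, hu, hn⟩ := (infinite_tr (K := K) (x := x) (K.rank k)).exists_gt n
      refine ⟨u, hu, ref_iff.2 (.inl (base_mono hn.le ?_))⟩
      rw [base, PiNat.mem_cylinder_iff_eq.1 hxy]
      exact disjoint_left.2 fun z hz => hsub hz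
    · have : x ∈ (K.set k)ᶜ := hx
      rw [K.compl_eq k h1] at this
      obtain ⟨n, hn⟩ := mem_iUnion.1 this
      have hlt := K.child_lt k h1 n
      obtain ⟨v, hv, hd⟩ := exists_tr_dec (K := K) (x := x) hlt
      refine ⟨v, hv, ref_iff.2 (.inr ⟨v, n, pre_refl _ _, hlt, hd, fun hr => ?_⟩)⟩
      exact (ih _ hlt rfl).2 ⟨v, hv.mono hlt.le, hr⟩ hn
  · rintro ⟨u, hu, hr⟩ hx
    rcases ref_iff.1 hr with hb | ⟨v, n, hpre, hlt, hd, hnr⟩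
    · exact disjoint_left.1 hb (PiNat.self_mem_cylinder x u) hx
    · have hv := hu.of_pre hpre
      have h1 : K.rank k ≠ 1 := fun h =>
        absurd (K.one_le_rank (K.child k n)) (not_le.2 (h ▸ hlt))
      have hc : x ∉ K.set (K.child k n) := fun hc => by
        have : x ∈ (K.set k)ᶜ := by
          rw [K.compl_eq k h1]
          exact mem_iUnion.2 ⟨n, hc⟩
        exact this hx
      obtain ⟨u', hu', hr'⟩ := (ih _ hlt rfl).1 hc
      obtain ⟨m, hm, hgt⟩ := (infinite_tr (K := K) (x := x) (K.rank k)).exists_gt (max u' v)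
      have hm' := hm.mono hlt.le
      have hrm := ref_mono (hu'.pre hm' (by omega)) hr'
      exact hnr ((le_iff.1 (hv.le hlt (by omega) hm')).2 _ rfl hd hrm)

end Code

namespace SigmaPi

theorem sigma_biInter_finset {α : Ordinal.{0}} (hα : 1 ≤ α) (F : Finset ℕ)
    {S : ℕ → Set NNSpace} (h : ∀ k ∈ F, SigmaPi true α (S k)) :
    SigmaPi true α (⋂ k ∈ F, S k) := by
  induction F using Finset.induction_on with
  | empty => simpa using of_isOpen hα isOpen_univ
  | insert a F _ ih =>
    rw [Finset.set_biInter_insert]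
    exact sigma_inter (h a (F.mem_insert_self a)) (ih fun k hk => h k (F.mem_insert_of_mem hk))

end SigmaPi

namespace Code

variable {K : Code} {x : NNSpace} {r : ℕ} {B : Set NNSpace} {U : ℕ → Set NNSpace}

variable (K x) in
/-- `i` is the last stage before `n` that looks true at level `η` from `n`. -/
def LastLe (η : Ordinal.{0}) (i n : ℕ) : Prop :=
  i < n ∧ K.le x η i n ∧ ∀ i', i < i' → i' < n → ¬ K.le x η i' n

variable (K x) in
/-- `i` is the last stage before `n` that looks true below level `η` from `n`. -/
def LastPre (η : Ordinal.{0}) (i n : ℕ) : Prop :=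
  i < n ∧ K.pre x η i n ∧ ∀ i', i < i' → i' < n → ¬ K.pre x η i' n

variable (K x r B U) in
/-- The `σ`-ideals attached to the stages along `x`, given positive sets `U i`. -/
inductive Null : ℕ → Set NNSpace → Prop
  | empty (n : ℕ) : Null n ∅
  | low {n i k : ℕ} {S : Set NNSpace} (hk : k < n) (hr : K.rank k < K.rank r)
      (hS : SigmaPi true (K.rank k) S) (hi : K.LastLe x (K.rank k) i n) (h : Null i (S ∩ U i)) :
      Null n S
  | sep {n : ℕ} {S : Set NNSpace} (hn : ¬ K.ref x r n) (hS : SigmaPi true (K.rank r) S)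
      (hB : Disjoint S B) : Null n S
  | iUnion {n : ℕ} {S : ℕ → Set NNSpace} (h : ∀ m, Null n (S m)) : Null n (⋃ m, S m)
  | subset {n : ℕ} {S T : Set NNSpace} (h : Null n T) (hST : S ⊆ T) : Null n S

theorem exists_last {n : ℕ} {p : ℕ → Prop} {i : ℕ} (hi : i < n) (hp : p i) :
    ∃ j, i ≤ j ∧ j < n ∧ p j ∧ ∀ j', j < j' → j' < n → ¬ p j' := by
  classical
  have hb : i ≤ n - 1 := by omega
  refine ⟨Nat.findGreatest p (n - 1), Nat.le_findGreatest hb hp, ?_,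
    Nat.findGreatest_spec hb hp, fun j' h1 h2 => Nat.findGreatest_is_greatest h1 (by omega)⟩
  have := Nat.findGreatest_le (P := p) (n - 1)
  omega

theorem exists_lastLe (η : Ordinal.{0}) {i n : ℕ} (hi : i < n) (h : K.le x η i n) :
    ∃ j, i ≤ j ∧ K.LastLe x η j n := exists_last hi h

theorem exists_lastPre (η : Ordinal.{0}) {i n : ℕ} (hi : i < n) (h : K.pre x η i n) :
    ∃ j, i ≤ j ∧ K.LastPre x η j n := exists_last hi h

theorem LastLe.unique {η : Ordinal.{0}} {i j n : ℕ} (hi : K.LastLe x η i n)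
    (hj : K.LastLe x η j n) : i = j := by
  rcases lt_trichotomy i j with h | h | h
  · exact absurd hj.2.1 (hi.2.2 j h hj.1)
  · exact h
  · exact absurd hi.2.1 (hj.2.2 i h hi.1)

theorem Null.biUnion {n : ℕ} {ι : Type*} {s : Set ι} (hs : s.Countable) {S : ι → Set NNSpace}
    (h : ∀ i ∈ s, K.Null x r B U n (S i)) : K.Null x r B U n (⋃ i ∈ s, S i) := by
  rcases s.eq_empty_or_nonempty with rfl | hne
  · simpa using Null.empty n
  · obtain ⟨f, rfl⟩ := hs.exists_eq_range hne
    rw [biUnion_range]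
    exact .iUnion fun m => h _ ⟨m, rfl⟩

theorem Null.union {n : ℕ} {S T : Set NNSpace} (hS : K.Null x r B U n S)
    (hT : K.Null x r B U n T) : K.Null x r B U n (S ∪ T) := by
  rw [union_eq_iUnion]
  have := Null.biUnion (K := K) (x := x) (r := r) (B := B) (U := U) (n := n)
    (countable_univ (α := Bool)) (S := fun b => cond b S T) (by rintro (_ | _) - <;> assumption)
  simpa using this

theorem Null.exists_cover {n : ℕ} {Y : Set NNSpace} (h : K.Null x r B U n Y) :
    ∃ (T : ℕ → Set NNSpace) (S : Set NNSpace),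
      (∀ k < n, K.rank k < K.rank r → SigmaPi true (K.rank k) (T k) ∧
        ∀ i, K.LastLe x (K.rank k) i n → K.Null x r B U i (T k ∩ U i)) ∧
      SigmaPi true (K.rank r) S ∧ Disjoint S B ∧ (K.ref x r n → S = ∅) ∧
      Y ⊆ (⋃ k ∈ {k | k < n ∧ K.rank k < K.rank r}, T k) ∪ S := by
  have hempty : ∀ α : Ordinal.{0}, 1 ≤ α → SigmaPi true α ∅ :=
    fun α hα => SigmaPi.of_isOpen hα isOpen_empty
  induction h with
  | empty n =>
    exact ⟨fun _ => ∅, ∅, fun k _ _ => ⟨hempty _ (K.one_le_rank k), fun i _ => by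
      simpa using Null.empty i⟩, hempty _ (K.one_le_rank r), by simp, fun _ => rfl, by simp⟩
  | @low n i k S hk hr hS hi h _ =>
    refine ⟨fun k' => if k' = k then S else ∅, ∅, fun k' _ _ => ?_,
      hempty _ (K.one_le_rank r), by simp, fun _ => rfl, ?_⟩
    · by_cases hkk : k' = k
      · subst hkk
        simp only [if_true]
        exact ⟨hS, fun i' hi' => hi.unique hi' ▸ h⟩
      · simp only [hkk, if_false]
        exact ⟨hempty _ (K.one_le_rank k'), fun i _ => by simpa using Null.empty i⟩
    · intro y hy
      refine .inl (mem_biUnion (x := k) ⟨hk, hr⟩ ?_)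
      simpa using hy
  | @sep n S hn hS hB =>
    exact ⟨fun _ => ∅, S, fun k _ _ => ⟨hempty _ (K.one_le_rank k), fun i _ => by
      simpa using Null.empty i⟩, hS, hB, fun h => absurd h hn, subset_union_right⟩
  | @iUnion n S _ ih =>
    choose T S' hT hS' hd he hsub using ih
    refine ⟨fun k => ⋃ m, T m k, ⋃ m, S' m, fun k hk hr => ⟨SigmaPi.sigma_iUnion fun m =>
      (hT m k hk hr).1, fun i hi => ?_⟩, SigmaPi.sigma_iUnion hS', disjoint_iUnion_left.2 hd,
      fun h => by simp [he _ h], iUnion_subset fun m => (hsub m).trans ?_⟩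
    · rw [iUnion_inter]
      exact .iUnion fun m => (hT m k hk hr).2 i hi
    · exact union_subset_union (iUnion₂_mono fun k _ => subset_iUnion (fun m => T m k) m)
        (subset_iUnion S' m)
  | @subset n S T _ hST ih =>
    obtain ⟨T', S', h1, h2, h3, h4, h5⟩ := ih
    exact ⟨T', S', h1, h2, h3, h4, hST.trans h5⟩

theorem exists_lt_forall_not_le {η : Ordinal.{0}} {j n : ℕ} (hj : j + 1 < n)
    (h : ∀ i, j < i → i < n → ¬ K.pre x η i n) :
    ∃ ζ < η, ∀ i, j < i → i < n → ¬ K.le x ζ i n := by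
  have : ∀ i ∈ Finset.Ioo j n, ∃ ζ < η, ¬ K.le x ζ i n := by
    intro i hi
    rw [Finset.mem_Ioo] at hi
    by_contra! hc
    exact h i hi.1 hi.2 ⟨hi.2.le, hc⟩
  choose! f hf hfn using this
  have hne : (Finset.Ioo j n).Nonempty := ⟨j + 1, Finset.mem_Ioo.2 ⟨j.lt_succ_self, hj⟩⟩
  refine ⟨(Finset.Ioo j n).sup' hne f, (Finset.sup'_lt_iff hne).2 hf, fun i hi hin hle => ?_⟩
  have hi' := Finset.mem_Ioo.2 ⟨hi, hin⟩
  exact hfn i hi' (hle.mono (Finset.le_sup' f hi'))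

theorem exists_level {δ : Ordinal.{0}} {j n : ℕ} (hj : j + 1 < n) (h : K.LastPre x δ j n) :
    ∃ ζ < δ, 1 ≤ ζ ∧ (∀ i, j < i → i < n → ¬ K.le x ζ i n) ∧
      ∃ j', j < j' ∧ K.LastPre x ζ j' n := by
  obtain ⟨ζ, ⟨hζδ, hζ⟩, hmin⟩ := WellFounded.has_min (wellFounded_lt (α := Ordinal.{0}))
    {ζ | ζ < δ ∧ ∀ i, j < i → i < n → ¬ K.le x ζ i n} (exists_lt_forall_not_le hj h.2.2)
  have hex : ∃ i, j < i ∧ i < n ∧ K.pre x ζ i n := by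
    by_contra! hc
    obtain ⟨ζ', hlt, hζ'⟩ := exists_lt_forall_not_le hj hc
    exact hmin ζ' ⟨hlt.trans hζδ, hζ'⟩ hlt
  obtain ⟨i, hji, hin, hpre⟩ := hex
  refine ⟨ζ, hζδ, ?_, hζ, ?_⟩
  · rw [Order.one_le_iff_pos]
    refine pos_of_ne_zero ?_
    rintro rfl
    exact hζ i hji hin ((pre_one hin.le).2 0 zero_lt_one)
  · obtain ⟨j', hij, hj'⟩ := exists_lastPre ζ hin hpre
    exact ⟨j', hji.trans_le hij, hj'⟩

theorem not_null_of_lastPre {n : ℕ} {N : Set NNSpace} (hN : IsOpen N)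
    (hU : ∀ i < n, ¬ K.Null x r B U i (U i)) (hUN : ∀ i, i + 1 = n → U i ⊆ N) {T : ℕ → Set NNSpace}
    (hT : ∀ k < n, K.rank k < K.rank r → SigmaPi true (K.rank k) (T k) ∧
        ∀ i, K.LastLe x (K.rank k) i n → K.Null x r B U i (T k ∩ U i)) (δ : Ordinal.{0}) :
    1 ≤ δ → δ ≤ K.rank r →
      SigmaPi true δ (N ∩ ⋂ k ∈ (Finset.range n).filter (K.rank · < δ), (T k)ᶜ) ∧
      ∀ j, K.LastPre x δ j n → ¬ K.Null x r B U j
        (U j ∩ (N ∩ ⋂ k ∈ (Finset.range n).filter (K.rank · < δ), (T k)ᶜ)) := by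
  classical
  induction δ using WellFoundedLT.induction with
  | ind δ ih =>
  intro h1 hδ
  refine ⟨SigmaPi.sigma_inter (.of_isOpen h1 hN) (SigmaPi.sigma_biInter_finset h1 _ fun k hk => ?_),
    fun j hj hnull => ?_⟩
  · rw [Finset.mem_filter, Finset.mem_range] at hk
    exact SigmaPi.sigma_of_pi (.compl _ _ (hT k hk.1 (hk.2.trans_le hδ)).1) hk.2
  have key : ∀ Y : Set NNSpace, (∀ y ∈ Y, y ∈ U j ∧ y ∈ N) →
      (∀ k < n, K.rank k < δ → K.Null x r B U j (T k ∩ U j) ∨ ∀ y ∈ Y, y ∉ T k) →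
      K.Null x r B U j Y := by
    intro Y hY hk
    have h2 : K.Null x r B U j (⋃ k ∈ {k | k < n ∧ K.rank k < δ ∧
        K.Null x r B U j (T k ∩ U j)}, T k ∩ U j) :=
      Null.biUnion (to_countable _) fun k hk => hk.2.2
    refine (hnull.union h2).subset fun y hy => ?_
    by_cases hyT : ∃ k, (k < n ∧ K.rank k < δ ∧ K.Null x r B U j (T k ∩ U j)) ∧ y ∈ T k
    · obtain ⟨k, hk, hyk⟩ := hyT
      exact .inr (mem_biUnion (x := k) hk ⟨hyk, (hY y hy).1⟩)
    · refine .inl ⟨(hY y hy).1, (hY y hy).2, mem_iInter₂.2 fun k hk' hyk => ?_⟩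
      rw [Finset.mem_filter, Finset.mem_range] at hk'
      rcases hk k hk'.1 hk'.2 with h | h
      · exact hyT ⟨k, ⟨hk'.1, hk'.2, h⟩, hyk⟩
      · exact h y hy hyk
  rcases Nat.lt_or_ge (j + 1) n with hjn | hjn
  · obtain ⟨ζ, hζδ, hζ1, hζ, j', hjj', hj'⟩ := exists_level hjn hj
    obtain ⟨hP, hQ⟩ := ih ζ hζδ hζ1 (hζδ.le.trans hδ)
    set P := N ∩ ⋂ k ∈ (Finset.range n).filter (K.rank · < ζ), (T k)ᶜ with hPdef
    have descend : ∀ i, j ≤ i → K.le x ζ i j' → ¬ K.Null x r B U i (U i ∩ P) →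
        ¬ K.Null x r B U j (U j ∩ P) := by
      intro i
      induction i using Nat.strong_induction_on with
      | _ i ihi =>
      intro hji hij' hi
      rcases hji.eq_or_lt with rfl | hlt
      · exact hi
      have hjlej' : K.le x ζ j j' := le_of_pre hjj'.le (hj.2.1.2 ζ hζδ) hj'.2.1
      have hjlei : K.le x ζ j i := le_of_pre hji hjlej' hij'.pre
      obtain ⟨i₁, hji₁, hi₁⟩ := exists_lastLe ζ hlt hjlei
      refine ihi i₁ hi₁.1 hji₁ (le_trans hi₁.2.1 hij') fun hn => hi ?_
      have hin : K.pre x ζ i n := pre_trans hij'.pre hj'.2.1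
      obtain ⟨k, hki, rfl⟩ := exists_lt_of_not_le hin
        (hζ i hlt (hij'.pre.1.trans_lt hj'.1))
      exact (Null.low hki (hζδ.trans_le hδ) hP hi₁ (by rwa [inter_comm])).subset inter_subset_right
    refine descend j' hjj'.le (le_refl _ _) (hQ j' hj') (key _ (fun y hy => ⟨hy.1, hy.2.1⟩) ?_)
    intro k hk hkδ
    rcases lt_or_ge (K.rank k) ζ with hlt | hge
    · refine .inr fun y hy => mem_iInter₂.1 hy.2.2 k ?_
      simp [hk, hlt]
    · refine .inl ((hT k hk (hkδ.trans_le hδ)).2 j ⟨hj.1, hj.2.1.2 _ hkδ, fun i hi hin hle => ?_⟩)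
      exact hζ i hi hin (hle.mono hge)
  · have hjn' : j + 1 = n := le_antisymm hj.1 hjn
    refine hU j hj.1 (key _ (fun y hy => ⟨hy, hUN j hjn' hy⟩) fun k hk hkδ => ?_)
    exact .inl ((hT k hk (hkδ.trans_le hδ)).2 j ⟨hj.1, hj.2.1.2 _ hkδ, fun i hi hin => by omega⟩)

theorem not_null_extend {n i : ℕ} {N : Set NNSpace} (hN : IsOpen N)
    (hU : ∀ i < n, ¬ K.Null x r B U i (U i)) (hUN : ∀ i, i + 1 = n → U i ⊆ N)
    (hi : K.LastPre x (K.rank r) i n) :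
    ((K.ref x r n → K.ref x r i) → ¬ K.Null x r B U n (U i ∩ N)) ∧
    (K.ref x r n → ¬ K.ref x r i → ¬ K.Null x r B U n (B ∩ N)) := by
  have aux : ∀ {Y : Set NNSpace} {T : ℕ → Set NNSpace} {S : Set NNSpace},
      Y ⊆ (⋃ k ∈ {k | k < n ∧ K.rank k < K.rank r}, T k) ∪ S →
      Y ∩ ⋂ k ∈ (Finset.range n).filter (K.rank · < K.rank r), (T k)ᶜ ⊆ S := by
    intro Y T S hY z hz
    rcases hY hz.1 with h | h
    · obtain ⟨k, hk, hzk⟩ := mem_iUnion₂.1 h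
      exact absurd hzk (mem_iInter₂.1 hz.2 k (by simpa using hk))
    · exact h
  constructor
  · intro htype hnull
    obtain ⟨T, S, hT, hS, hSB, hSe, hsub⟩ := hnull.exists_cover
    refine (not_null_of_lastPre hN hU hUN hT _ (K.one_le_rank r) le_rfl).2 i hi ?_
    rw [← inter_assoc]
    refine Null.subset ?_ (aux hsub)
    by_cases hn : K.ref x r n
    · rw [hSe hn]
      exact .empty i
    · exact .sep (fun h => hn (ref_mono hi.2.1 h)) hS hSB
  · intro hn hni hnull
    obtain ⟨T, S, hT, hS, hSB, hSe, hsub⟩ := hnull.exists_cover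
    obtain ⟨hP, hQ⟩ := not_null_of_lastPre hN hU hUN hT _ (K.one_le_rank r) le_rfl
    refine hQ i hi ((Null.sep hni hP ?_).subset inter_subset_right)
    rw [disjoint_left]
    intro z hz hzB
    have := aux hsub ⟨⟨hzB, hz.1⟩, hz.2⟩
    rw [hSe hn] at this
    exact this

end Code

namespace Code

variable {K : Code} {x y : NNSpace} {r : ℕ} {B : Set NNSpace} {U U' : ℕ → Set NNSpace}

theorem Null.congr {n : ℕ} {Y : Set NNSpace} (h : K.Null x r B U n Y)
    (hxy : ∀ i < n, x i = y i) (hU : ∀ i < n, U i = U' i) : K.Null y r B U' n Y := by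
  induction h with
  | empty n => exact .empty n
  | @low n i k S hk hr hS hi _ ih =>
    refine .low hk hr hS (i := i) ⟨hi.1, (le_congr hxy le_rfl).1 hi.2.1, fun i' h1 h2 h3 =>
      hi.2.2 i' h1 h2 ((le_congr hxy le_rfl).2 h3)⟩ ?_
    rw [← hU i hi.1]
    exact ih (fun j hj => hxy j (hj.trans hi.1)) fun j hj => hU j (hj.trans hi.1)
  | sep hn hS hB => exact .sep (fun h => hn ((ref_congr hxy le_rfl).2 h)) hS hB
  | iUnion _ ih => exact .iUnion fun m => ih m hxy hU
  | subset _ hST ih => exact (ih hxy hU).subset hST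

variable (F : Prop → NNSpace → NNSpace)

variable (K x r) in
/-- The positive set attached to a stage. -/
def img (E : ℕ → Set NNSpace) (n : ℕ) : Set NNSpace := F (K.ref x r n) '' E n

variable (K x r) in
/-- The requirements on the set `E n`, in terms of the sets `E i` for `i < n`. -/
structure Good (n : ℕ) (E : ℕ → Set NNSpace) : Prop where
  not_null : ¬ K.Null x r (range (F True)) (K.img x r F E) n (K.img x r F E n)
  subset : ∀ i, K.LastPre x (K.rank r) i n → (K.ref x r n → K.ref x r i) → E n ⊆ E i
  source : ∃ z, E n ⊆ PiNat.cylinder z n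
  target : ∃ w, K.img x r F E n ⊆ PiNat.cylinder w n
  coherent : ∀ i w, i + 1 = n → K.img x r F E i ⊆ PiNat.cylinder w i →
    K.img x r F E n ⊆ PiNat.cylinder w i

variable {F}

theorem img_congr {E E' : ℕ → Set NNSpace} {n i : ℕ} (hxy : ∀ i < n, x i = y i) (hi : i ≤ n)
    (hE : E i = E' i) : K.img x r F E i = K.img y r F E' i := by
  rw [img, img, hE, propext (ref_congr hxy hi)]

theorem Good.congr {n : ℕ} {E E' : ℕ → Set NNSpace} (h : K.Good x r F n E)
    (hxy : ∀ i < n, x i = y i) (hE : ∀ i ≤ n, E i = E' i) : K.Good y r F n E' := by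
  have himg : ∀ i ≤ n, K.img x r F E i = K.img y r F E' i := fun i hi =>
    img_congr hxy hi (hE i hi)
  refine ⟨fun hn => h.not_null ?_, fun i hi hr => ?_, ?_, ?_, fun i w hi hw => ?_⟩
  · rw [himg n le_rfl]
    exact hn.congr (fun i hi => (hxy i hi).symm) fun i hi => (himg i hi.le).symm
  · rw [← hE n le_rfl, ← hE i hi.1.le]
    refine h.subset i ⟨hi.1, (pre_congr hxy le_rfl).2 hi.2.1, fun i' h1 h2 h3 =>
      hi.2.2 i' h1 h2 ((pre_congr hxy le_rfl).1 h3)⟩ fun hn => ?_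
    exact (ref_congr hxy hi.1.le).2 (hr ((ref_congr hxy le_rfl).1 hn))
  · rw [← hE n le_rfl]
    exact h.source
  · rw [← himg n le_rfl]
    exact h.target
  · rw [← himg n le_rfl]
    rw [← himg i (by omega)] at hw
    exact h.coherent i w hi hw

theorem exists_positive_start {n : ℕ} {E : ℕ → Set NNSpace}
    (hsep : ∀ S, SigmaPi true (K.rank r) S → range (F False) ⊆ S → ¬ Disjoint S (range (F True)))
    (hE : ∀ i < n, K.Good x r F i E) :
    ∃ (N D : Set NNSpace),
      (∀ i, K.LastPre x (K.rank r) i n → (K.ref x r n → K.ref x r i) → D ⊆ E i) ∧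
      (∀ i w, i + 1 = n → K.img x r F E i ⊆ PiNat.cylinder w i → N ⊆ PiNat.cylinder w i) ∧
      ¬ K.Null x r (range (F True)) (K.img x r F E) n (F (K.ref x r n) '' D ∩ N) := by
  rcases Nat.eq_zero_or_pos n with rfl | hpos
  · refine ⟨univ, univ, fun i hi => absurd hi.1 (Nat.not_lt_zero i), fun i w hi => by omega, ?_⟩
    rw [image_univ, inter_univ]
    intro hn
    obtain ⟨T, S, -, hS, hSB, hSe, hsub⟩ := hn.exists_cover
    have hsub' : range (F (K.ref x r 0)) ⊆ S := fun z hz => by simpa using hsub hz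
    by_cases hr : K.ref x r 0
    · rw [hSe hr] at hsub'
      exact hsub' ⟨0, rfl⟩
    · rw [eq_false hr] at hsub'
      exact hsep S hS hsub' hSB
  · obtain ⟨i, -, hi⟩ := exists_lastPre (K.rank r) hpos (pre_zero (K := K) (x := x) _ n)
    obtain ⟨m, rfl⟩ : ∃ m, n = m + 1 := ⟨n - 1, by omega⟩
    obtain ⟨w, hw⟩ := (hE m m.lt_succ_self).target
    have hUN : ∀ i, i + 1 = m + 1 → K.img x r F E i ⊆ PiNat.cylinder w m := by
      rintro i hi
      obtain rfl : i = m := by omega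
      exact hw
    have hne : (K.img x r F E m).Nonempty := by
      by_contra h
      rw [not_nonempty_iff_eq_empty] at h
      exact (hE m m.lt_succ_self).not_null (h ▸ .empty m)
    have hcoh : ∀ i w', i + 1 = m + 1 → K.img x r F E i ⊆ PiNat.cylinder w' i →
        PiNat.cylinder w m ⊆ PiNat.cylinder w' i := by
      rintro i w' hi hw'
      obtain rfl : i = m := by omega
      obtain ⟨u, hu⟩ := hne
      rw [← PiNat.mem_cylinder_iff_eq.1 (hw hu), PiNat.mem_cylinder_iff_eq.1 (hw' hu)]
    have hext := not_null_extend (PiNat.isOpen_cylinder _ w m) (fun i hi => (hE i hi).not_null)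
      hUN hi
    have huniq : ∀ i', K.LastPre x (K.rank r) i' (m + 1) → i' = i := by
      intro i' hi'
      rcases lt_trichotomy i i' with h | h | h
      · exact absurd hi'.2.1 (hi.2.2 i' h hi'.1)
      · exact h.symm
      · exact absurd hi.2.1 (hi'.2.2 i h hi.1)
    by_cases htype : K.ref x r (m + 1) → K.ref x r i
    · refine ⟨PiNat.cylinder w m, E i, fun i' hi' _ => (huniq i' hi').symm ▸ le_rfl, hcoh, ?_⟩
      have : K.ref x r (m + 1) = K.ref x r i := propext ⟨htype, ref_mono hi.2.1⟩
      rw [this]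
      exact hext.1 htype
    · rw [Classical.not_imp] at htype
      refine ⟨PiNat.cylinder w m, univ, fun i' hi' h => ?_, hcoh, ?_⟩
      · exact absurd (huniq i' hi' ▸ h htype.1) htype.2
      · rw [image_univ, eq_true htype.1]
        exact hext.2 htype.1 htype.2

theorem exists_good {n : ℕ} {E : ℕ → Set NNSpace}
    (hsep : ∀ S, SigmaPi true (K.rank r) S → range (F False) ⊆ S → ¬ Disjoint S (range (F True)))
    (hE : ∀ i < n, K.Good x r F i E) : ∃ D, K.Good x r F n (Function.update E n D) := by
  obtain ⟨N, D, hsub, hcoh, hnull⟩ := exists_positive_start hsep hE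
  let c : NNSpace → (Fin n → ℕ) × (Fin n → ℕ) := fun z =>
    (fun i => z i, fun i => F (K.ref x r n) z i)
  have hex : ∃ l, ¬ K.Null x r (range (F True)) (K.img x r F E) n
      (F (K.ref x r n) '' (D ∩ F (K.ref x r n) ⁻¹' N ∩ c ⁻¹' {l})) := by
    by_contra! hall
    refine hnull ((Null.biUnion (countable_univ) fun l _ => hall l).subset ?_)
    rintro _ ⟨⟨z, hz, rfl⟩, hzN⟩
    exact mem_biUnion (mem_univ (c z)) ⟨z, ⟨⟨hz, hzN⟩, rfl⟩, rfl⟩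
  obtain ⟨l, hl⟩ := hex
  refine ⟨D ∩ F (K.ref x r n) ⁻¹' N ∩ c ⁻¹' {l}, ?_⟩
  set D' := D ∩ F (K.ref x r n) ⁻¹' N ∩ c ⁻¹' {l} with hD'
  have hne : ∀ i < n, Function.update E n D' i = E i := fun i hi =>
    Function.update_of_ne hi.ne _ _
  have himg : ∀ i < n, K.img x r F (Function.update E n D') i = K.img x r F E i := fun i hi => by
    rw [img, img, hne i hi]
  have himgn : K.img x r F (Function.update E n D') n = F (K.ref x r n) '' D' := by
    rw [img, Function.update_self]
  have hnonempty : D'.Nonempty := by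
    by_contra h
    rw [not_nonempty_iff_eq_empty] at h
    rw [h, image_empty] at hl
    exact hl (.empty n)
  obtain ⟨z₀, hz₀⟩ := hnonempty
  have hc : ∀ z ∈ D', c z = c z₀ := fun z hz => hz.2.trans hz₀.2.symm
  refine ⟨fun h => hl ?_, fun i hi hr => ?_, ⟨z₀, ?_⟩, ⟨F (K.ref x r n) z₀, ?_⟩, fun i w hi hw => ?_⟩
  · rw [himgn] at h
    exact h.congr (fun _ _ => rfl) himg
  · rw [Function.update_self, hne i hi.1]
    exact fun z hz => hsub i hi hr hz.1.1
  · rw [Function.update_self]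
    intro z hz
    exact PiNat.mem_cylinder_iff.2 fun i hi => congr_fun (congr_arg Prod.fst (hc z hz)) ⟨i, hi⟩
  · rw [himgn]
    rintro _ ⟨z, hz, rfl⟩
    exact PiNat.mem_cylinder_iff.2 fun i hi => congr_fun (congr_arg Prod.snd (hc z hz)) ⟨i, hi⟩
  · rw [himg i (by omega)] at hw
    rw [himgn]
    rintro _ ⟨z, hz, rfl⟩
    exact hcoh i w hi hw hz.1.2

/-- `x` with all values from `n` on replaced by `0`. -/
def trunc (x : NNSpace) (n : ℕ) : NNSpace := fun i => if i < n then x i else 0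

variable (K r F) in
/-- A choice of sets meeting the requirements `Good`, depending at stage `n` on the first `n`
values of `x` only. -/
noncomputable def tree (x : NNSpace) (n : ℕ) : Set NNSpace :=
  let E : ℕ → Set NNSpace := fun i => if _ : i < n then tree x i else ∅
  Classical.epsilon fun D => K.Good (trunc x n) r F n (Function.update E n D)
termination_by n

theorem tree_congr {n : ℕ} (hxy : ∀ i < n, x i = y i) : K.tree r F x n = K.tree r F y n := by
  induction n using Nat.strong_induction_on with
  | _ n ih =>
  have h1 : trunc x n = trunc y n := by
    ext i
    by_cases hi : i < n <;> simp [trunc, hi, hxy]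
  have h2 : (fun i => if _ : i < n then K.tree r F x i else ∅) =
      fun i => if _ : i < n then K.tree r F y i else ∅ := by
    ext1 i
    by_cases hi : i < n
    · simp only [hi, dite_true]
      exact ih i hi fun j hj => hxy j (hj.trans hi)
    · simp only [hi, dite_false]
  rw [tree, tree]
  simp only [h1, h2]

theorem good_tree
    (hsep : ∀ S, SigmaPi true (K.rank r) S → range (F False) ⊆ S → ¬ Disjoint S (range (F True)))
    (n : ℕ) : K.Good x r F n (K.tree r F x) := by
  classical
  induction n using Nat.strong_induction_on with
  | _ n ih =>
  have htr : ∀ i < n, x i = trunc x n i := fun i hi => by simp [trunc, hi]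
  set E : ℕ → Set NNSpace := fun i => if _ : i < n then K.tree r F x i else ∅ with hE
  have hEt : ∀ i < n, K.tree r F x i = E i := fun i hi => by simp [hE, hi]
  have hex : ∃ D, K.Good (trunc x n) r F n (Function.update E n D) :=
    exists_good hsep fun i hi => (ih i hi).congr (fun j hj => htr j (hj.trans hi))
      fun j hj => hEt j (hj.trans_lt hi)
  have hn : K.tree r F x n =
      Classical.epsilon fun D => K.Good (trunc x n) r F n (Function.update E n D) := by
    rw [tree]
  refine (Classical.epsilon_spec hex).congr (fun i hi => (htr i hi).symm) fun i hi => ?_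
  rcases hi.eq_or_lt with rfl | hi
  · rw [Function.update_self, hn]
  · rw [Function.update_of_ne hi.ne, hEt i hi]

theorem Good.nonempty {n : ℕ} {E : ℕ → Set NNSpace} (h : K.Good x r F n E) : (E n).Nonempty := by
  by_contra hn
  rw [not_nonempty_iff_eq_empty] at hn
  refine h.not_null ?_
  rw [img, hn, image_empty]
  exact .empty n

theorem subset_of_tr {E : ℕ → Set NNSpace} (hE : ∀ n, K.Good x r F n E) {i j : ℕ} (hij : i ≤ j)
    (hi : K.Tr x (K.rank r) i) (hj : K.Tr x (K.rank r) j) (h : K.ref x r j → K.ref x r i) :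
    E j ⊆ E i := by
  induction j using Nat.strong_induction_on with
  | _ j ih =>
  rcases hij.eq_or_lt with rfl | hlt
  · exact le_rfl
  obtain ⟨m, him, hm⟩ := exists_lastPre (K.rank r) hlt (hi.pre hj hij)
  have htm := hj.of_pre hm.2.1
  refine ((hE j).subset m hm fun hr => ref_mono (hi.pre htm him) (h hr)).trans ?_
  exact ih m hm.1 him htm fun hr => h (ref_mono hm.2.1 hr)

theorem mem_range_of_tr {E : ℕ → Set NNSpace} (hE : ∀ n, K.Good x r F n E) {p : Prop}
    (hF : Continuous (F p)) {u : NNSpace} (hu : ∀ n, K.img x r F E n ⊆ PiNat.cylinder u n)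
    (hp : ∀ m, ∃ n ≥ m, K.Tr x (K.rank r) n ∧ (K.ref x r n ↔ p)) : u ∈ range (F p) := by
  choose a ha hat hap using hp
  choose q hq using fun n => (hE n).nonempty
  have hsub : ∀ m n, E (a m) ⊆ E (a n) ∨ E (a n) ⊆ E (a m) := fun m n => by
    rcases le_total (a m) (a n) with h | h
    · exact .inr (subset_of_tr hE h (hat _) (hat _) fun h => (hap _).2 ((hap _).1 h))
    · exact .inl (subset_of_tr hE h (hat _) (hat _) fun h => (hap _).2 ((hap _).1 h))
  have hagree : ∀ n k, k < n → ∀ e ∈ E n, ∀ e' ∈ E n, e k = e' k := by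
    intro n k hk e he e' he'
    obtain ⟨z, hz⟩ := (hE n).source
    rw [PiNat.mem_cylinder_iff.1 (hz he) k hk, PiNat.mem_cylinder_iff.1 (hz he') k hk]
  let z : NNSpace := fun k => q (a (k + 1)) k
  have hz : ∀ m, q (a m) ∈ PiNat.cylinder z (a m) := by
    refine fun m => PiNat.mem_cylinder_iff.2 fun k hk => ?_
    rcases hsub m (k + 1) with h | h
    · exact hagree (a (k + 1)) k (ha _) _ (h (hq _)) (q (a (k + 1))) (hq _)
    · exact hagree (a m) k hk _ (hq _) (q (a (k + 1))) (h (hq _))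
  refine ⟨z, funext fun k => ?_⟩
  have hopen : IsOpen {z' | F p z' k = F p z k} :=
    (isOpen_discrete {F p z k}).preimage ((continuous_apply k).comp hF)
  obtain ⟨_, ⟨z₁, n, rfl⟩, hzn, hsub'⟩ := (PiNat.isTopologicalBasis_cylinders
    (fun _ : ℕ => ℕ)).exists_subset_of_mem_open (show z ∈ {z' | F p z' k = F p z k} from rfl) hopen
  rw [← PiNat.mem_cylinder_iff_eq.1 hzn] at hsub'
  set m := max n (k + 1) with hm
  have hnm : n ≤ a m := (le_max_left _ _).trans (ha m)
  have hkm : k + 1 ≤ a m := (le_max_right _ _).trans (ha m)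
  have h1 : F p (q (a m)) k = F p z k := hsub' (PiNat.cylinder_anti z hnm (hz m))
  have h2 : F p (q (a m)) ∈ K.img x r F E (a m) :=
    ⟨q (a m), hq _, by rw [propext (hap m)]⟩
  rw [← h1]
  exact PiNat.mem_cylinder_iff.1 (hu _ h2) k hkm

theorem exists_reduction (K : Code) (r : ℕ) {F : Prop → NNSpace → NNSpace}
    (hF : ∀ p, Continuous (F p))
    (hsep : ∀ S, SigmaPi true (K.rank r) S → range (F False) ⊆ S → ¬ Disjoint S (range (F True))) :
    ∃ φ : NNSpace → NNSpace, Continuous φ ∧ ∀ x, φ x ∈ range (F (x ∉ K.set r)) := by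
  have hgood : ∀ x n, K.Good x r F n (K.tree r F x) := fun x n => good_tree hsep n
  have hne : ∀ x n, (K.img x r F (K.tree r F x) n).Nonempty := fun x n =>
    (hgood x n).nonempty.image _
  let φ : NNSpace → NNSpace := fun x k =>
    Classical.epsilon (fun u => u ∈ K.img x r F (K.tree r F x) (k + 1)) k
  have hmem : ∀ x n, K.img x r F (K.tree r F x) n ⊆ PiNat.cylinder (φ x) n := by
    intro x n u hu
    refine PiNat.mem_cylinder_iff.2 fun k hk => ?_
    induction n, (show k + 1 ≤ n from hk) using Nat.le_induction generalizing u with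
    | base =>
      obtain ⟨w, hw⟩ := (hgood x (k + 1)).target
      have h1 := PiNat.mem_cylinder_iff.1 (hw hu) k k.lt_succ_self
      have h2 := PiNat.mem_cylinder_iff.1 (hw (Classical.epsilon_spec (hne x (k + 1)))) k
        k.lt_succ_self
      exact h1.trans h2.symm
    | succ n hn ih =>
      obtain ⟨w, hw⟩ := (hgood x n).target
      obtain ⟨v, hv⟩ := hne x n
      rw [← ih hv hn, PiNat.mem_cylinder_iff.1 (hw hv) k hn]
      exact PiNat.mem_cylinder_iff.1 ((hgood x (n + 1)).coherent n w rfl hw hu) k hn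
  refine ⟨φ, continuous_pi fun k => ?_, fun x => ?_⟩
  · refine IsLocallyConstant.continuous ((IsLocallyConstant.iff_exists_open _).2 fun x =>
      ⟨PiNat.cylinder x (k + 1), PiNat.isOpen_cylinder _ x _, PiNat.self_mem_cylinder x _,
        fun y hy => ?_⟩)
    have hxy : ∀ i < k + 1, y i = x i := PiNat.mem_cylinder_iff.1 hy
    have : K.img y r F (K.tree r F y) (k + 1) = K.img x r F (K.tree r F x) (k + 1) :=
      img_congr hxy le_rfl (tree_congr hxy)
    simp only [φ, this]
  · refine mem_range_of_tr (hgood x) (hF _) (hmem x) fun m => ?_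
    have hinf := infinite_tr (K := K) (x := x) (K.rank r)
    by_cases hx : x ∈ K.set r
    · obtain ⟨n, hn, hm⟩ := hinf.exists_gt m
      refine ⟨n, hm.le, hn, iff_of_false (fun h => notMem_iff.2 ⟨n, hn, h⟩ hx) (by simpa using hx)⟩
    · obtain ⟨u, hu, hr⟩ := notMem_iff.1 hx
      obtain ⟨n, hn, hm⟩ := hinf.exists_gt (max m u)
      refine ⟨n, (le_max_left _ _).trans hm.le, hn, iff_of_true ?_ hx⟩
      exact ref_mono (hu.pre hn ((le_max_right _ _).trans hm.le)) hr

end Code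

theorem exists_separated_reduction {α : Ordinal.{0}} {V A B : Set NNSpace}
    (hV : SigmaPi false α V) (hA : MeasurableSet A) (hB : MeasurableSet B)
    (hsep : ∀ S, SigmaPi true α S → A ⊆ S → ¬ Disjoint S B) :
    ∃ φ : NNSpace → NNSpace, Continuous φ ∧ φ '' V ⊆ A ∧ φ '' Vᶜ ⊆ B := by
  classical
  have hAne : A.Nonempty := by
    by_contra h
    rw [not_nonempty_iff_eq_empty] at h
    exact hsep ∅ (.of_isOpen hV.one_le isOpen_empty) h.le (by simp)
  have hBne : B.Nonempty := by
    by_contra h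
    rw [not_nonempty_iff_eq_empty] at h
    exact hsep univ (.of_isOpen hV.one_le isOpen_univ) (subset_univ _) (by simp [h])
  have hA' := hA.analyticSet
  have hB' := hB.analyticSet
  rw [MeasureTheory.AnalyticSet] at hA' hB'
  obtain ⟨f, hf, rfl⟩ := hA'.resolve_left hAne.ne_empty
  obtain ⟨h, hh, rfl⟩ := hB'.resolve_left hBne.ne_empty
  obtain ⟨K, r, rfl, rfl⟩ := hV.exists_code
  obtain ⟨φ, hφ, hmem⟩ := K.exists_reduction r (F := fun p => if p then h else f)
    (fun p => by split_ifs <;> assumption) (by simpa using hsep)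
  refine ⟨φ, hφ, ?_, ?_⟩
  · rintro _ ⟨x, hx, rfl⟩
    simpa [hx] using hmem x
  · rintro _ ⟨x, hx, rfl⟩
    have : x ∉ K.set r := hx
    simpa [this] using hmem x

end

/-- Let `α ≥ 1` be a countable ordinal, `V` a `Π⁰_α` set, `W` a `Π⁰_α`-hard set, and
`(W i)` a partition of `W` into Borel sets.  Then there are a continuous `φ` and an
`i ∈ ℕ` with `φ(V) ⊆ W i` and `φ(Vᶜ) ⊆ Wᶜ`. -/
theorem pi0hard_partition_reduction (α : Ordinal.{0}) (hα₁ : 1 ≤ α)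
    (hαc : α.card ≤ Cardinal.aleph0) (V : Set NNSpace) (hV : SigmaPi false α V)
    (W : Set NNSpace) (hW : Pi0Hard α W) (Wi : ℕ → Set NNSpace)
    (hBorel : ∀ i, MeasurableSet (Wi i))
    (hdisj : ∀ i j, i ≠ j → Disjoint (Wi i) (Wi j))
    (hcover : ⋃ i, Wi i = W) :
    ∃ (φ : NNSpace → NNSpace) (i : ℕ), Continuous φ ∧
      φ '' V ⊆ Wi i ∧ φ '' Vᶜ ⊆ Wᶜ := by
  by_contra hno
  have hsep : ∀ i, ∃ S, SigmaPi true α S ∧ Wi i ⊆ S ∧ Disjoint S Wᶜ := by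
    intro i
    by_contra! hi
    have hWm : MeasurableSet W := hcover ▸ MeasurableSet.iUnion hBorel
    obtain ⟨φ, hφ, h1, h2⟩ := exists_separated_reduction hV (hBorel i) hWm.compl hi
    exact hno ⟨φ, i, hφ, h1, h2⟩
  choose S hS hWS hSW using hsep
  have hWeq : W = ⋃ i, S i := by
    refine Set.Subset.antisymm ?_ (Set.iUnion_subset fun i => ?_)
    · exact hcover ▸ Set.iUnion_mono hWS
    · exact Set.disjoint_compl_right_iff_subset.1 (hSW i)
  obtain ⟨T, hT, hTn⟩ := SigmaPi.exists_pi_not_sigma α hα₁ hαc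
  obtain ⟨φ, hφ, rfl⟩ := hW T hT
  refine hTn (SigmaPi.preimage ?_ hφ)
  rw [hWeq]
  exact SigmaPi.sigma_iUnion hS
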